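/- arXiv:1909.09958 — 2 statements merged into one kernel-verified Lean document; each statement's English description precedes it below -/
import Mathlib

section
/- Let 0 < p < 1/2, let f, g belong to L₁(K₀(px)dx), and let ω : (0,∞) → ℂ be measurable with ∫₀^∞ K₀(px)·|ω(x)|·x⁻¹ dx < ∞. Then ∫₀^∞ (f∗g)(x)·ω(x) dx = (2/π²) ∫₀^∞ τ·sinh(πτ)·(Ff)(τ)·(Fg)(τ)·q(τ) dτ, where q(τ) = ∫₀^∞ K_{iτ}(x)·ω(x)·x⁻¹ dx. -/
open MeasureTheory Real Set

/-- `K_{iτ}(x) = ∫₀^∞ exp(−x cosh u) cos(τu) du`. -/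
noncomputable def Kib (τ x : ℝ) : ℝ :=
  ∫ u in Ioi (0:ℝ), Real.exp (-x * Real.cosh u) * Real.cos (τ * u)

/-- `K₀(x) = ∫₀^∞ exp(−x cosh u) du`. -/
noncomputable def K0 (x : ℝ) : ℝ := ∫ u in Ioi (0:ℝ), Real.exp (-x * Real.cosh u)

/-- The Kontorovich–Lebedev transform. -/
noncomputable def KL (f : ℝ → ℂ) (τ : ℝ) : ℂ := ∫ x in Ioi (0:ℝ), (Kib τ x : ℂ) * f x

/-- The Kontorovich–Lebedev convolution. -/
noncomputable def KLconv (f g : ℝ → ℂ) (x : ℝ) : ℂ :=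
  (1/(2*x) : ℂ) * ∫ y in Ioi (0:ℝ), ∫ t in Ioi (0:ℝ),
    (Real.exp (-((y^2+t^2)/(2*y*t))*x - y*t/(2*x)) : ℂ) * f y * g t

open Filter Topology

/-- The integrand `exp (-x cosh (u + iδ)) e^{iτu}` of the Fourier representation of `K_{iτ}` along
the horizontal line of height `δ`. -/
noncomputable def shiftedKernel (x δ τ u : ℝ) : ℂ :=
  Complex.exp (-x * Complex.cosh (u + δ * Complex.I)) * Complex.exp (τ * u * Complex.I)

lemma integrable_inv_cosh : Integrable (fun u : ℝ => (Real.cosh u)⁻¹) := by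
  refine (integrable_inv_one_add_sq.const_mul 4).mono'
    (Real.continuous_cosh.inv₀ fun u => (Real.cosh_pos u).ne').aestronglyMeasurable
    (.of_forall fun u => ?_)
  have h : (1 + u ^ 2) / 4 ≤ Real.cosh u := by
    have h1 := Real.quadratic_le_exp_of_nonneg (abs_nonneg u)
    rw [sq_abs] at h1
    rw [← Real.cosh_abs, Real.cosh_eq]
    linarith [Real.exp_pos (-|u|), abs_nonneg u]
  rw [Real.norm_of_nonneg (inv_nonneg.2 (Real.cosh_pos u).le), ← div_eq_mul_inv,
    inv_le_comm₀ (Real.cosh_pos u) (by positivity), inv_div]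
  exact h

lemma exp_neg_le_factorial_div_pow {y : ℝ} (hy : 0 < y) (n : ℕ) :
    Real.exp (-y) ≤ n.factorial / y ^ n := by
  rw [Real.exp_neg, inv_le_comm₀ (Real.exp_pos y) (by positivity), inv_div]
  exact Real.pow_div_factorial_le_exp y hy.le n

lemma re_cosh_add_mul_I (u δ : ℝ) :
    (Complex.cosh (u + δ * Complex.I)).re = Real.cos δ * Real.cosh u := by
  rw [Complex.cosh_add, Complex.cosh_mul_I, Complex.sinh_mul_I]
  simp [← Complex.ofReal_cosh, ← Complex.ofReal_cos, ← Complex.ofReal_sin,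
    ← Complex.ofReal_sinh, mul_comm]

lemma norm_shiftedKernel (x δ τ u : ℝ) :
    ‖shiftedKernel x δ τ u‖ = Real.exp (-(x * Real.cos δ * Real.cosh u)) := by
  have h : (-(x : ℂ) * Complex.cosh (u + δ * Complex.I)).re = -(x * Real.cos δ * Real.cosh u) := by
    rw [neg_mul, Complex.neg_re, Complex.re_ofReal_mul, re_cosh_add_mul_I]; ring
  rw [shiftedKernel, norm_mul, Complex.norm_exp, h, Complex.norm_exp]
  simp

lemma continuous_shiftedKernel (x δ τ : ℝ) : Continuous (shiftedKernel x δ τ) := by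
  unfold shiftedKernel; fun_prop

lemma norm_sinh_add_mul_I_le (u δ : ℝ) :
    ‖Complex.sinh (u + δ * Complex.I)‖ ≤ Real.cosh u := by
  rw [Complex.sinh, Real.cosh_eq, norm_div]
  have h1 : ‖Complex.exp (u + δ * Complex.I)‖ = Real.exp u := by rw [Complex.norm_exp]; simp
  have h2 : ‖Complex.exp (-(u + δ * Complex.I))‖ = Real.exp (-u) := by rw [Complex.norm_exp]; simp
  have := norm_sub_le (Complex.exp (u + δ * Complex.I)) (Complex.exp (-(u + δ * Complex.I)))
  rw [h1, h2] at this
  simp only [Complex.norm_ofNat]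
  gcongr

lemma exp_neg_mul_cosh_le {c : ℝ} (hc : 0 < c) (u : ℝ) :
    Real.exp (-(c * Real.cosh u)) ≤ c⁻¹ * (Real.cosh u)⁻¹ := by
  have := exp_neg_le_factorial_div_pow (mul_pos hc (Real.cosh_pos u)) 1
  simpa [mul_inv, mul_comm] using this

lemma cosh_mul_exp_neg_mul_cosh_le {c : ℝ} (hc : 0 < c) (u : ℝ) :
    Real.cosh u * Real.exp (-(c * Real.cosh u)) ≤ 2 * (c⁻¹) ^ 2 * (Real.cosh u)⁻¹ := by
  have h := exp_neg_le_factorial_div_pow (mul_pos hc (Real.cosh_pos u)) 2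
  have hu := Real.cosh_pos u
  calc _ ≤ Real.cosh u * ((Nat.factorial 2 : ℕ) / (c * Real.cosh u) ^ 2) := by gcongr
    _ = _ := by simp [Nat.factorial]; field_simp

lemma integrable_exp_neg_mul_cosh {c : ℝ} (hc : 0 < c) :
    Integrable (fun u : ℝ => Real.exp (-(c * Real.cosh u))) :=
  (integrable_inv_cosh.const_mul c⁻¹).mono' (by fun_prop) (.of_forall fun u => by
    rw [Real.norm_of_nonneg (by positivity)]; exact exp_neg_mul_cosh_le hc u)

lemma integrable_cosh_mul_exp_neg_mul_cosh {c : ℝ} (hc : 0 < c) :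
    Integrable (fun u : ℝ => Real.cosh u * Real.exp (-(c * Real.cosh u))) :=
  (integrable_inv_cosh.const_mul (2 * (c⁻¹) ^ 2)).mono' (by fun_prop) (.of_forall fun u => by
    have := Real.cosh_pos u
    rw [Real.norm_of_nonneg (by positivity)]; exact cosh_mul_exp_neg_mul_cosh_le hc u)

lemma integrable_shiftedKernel {x δ : ℝ} (h : 0 < x * Real.cos δ) (τ : ℝ) :
    Integrable (shiftedKernel x δ τ) :=
  (integrable_exp_neg_mul_cosh h).mono' (continuous_shiftedKernel x δ τ).aestronglyMeasurable
    (.of_forall fun u => (norm_shiftedKernel x δ τ u).le)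

lemma integrable_sinh_mul_shiftedKernel {x δ : ℝ} (h : 0 < x * Real.cos δ) (τ : ℝ) :
    Integrable (fun u : ℝ => Complex.sinh (u + δ * Complex.I) * shiftedKernel x δ τ u) := by
  refine (integrable_cosh_mul_exp_neg_mul_cosh h).mono' ?_ (.of_forall fun u => ?_)
  · exact ((by fun_prop : Continuous fun u : ℝ => Complex.sinh (u + δ * Complex.I)).mul
      (continuous_shiftedKernel x δ τ)).aestronglyMeasurable
  · rw [norm_mul, norm_shiftedKernel]
    gcongr
    exact norm_sinh_add_mul_I_le u δ

lemma hasDerivAt_shiftedKernel (x δ τ u : ℝ) :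
    HasDerivAt (shiftedKernel x δ τ)
      ((τ * Complex.I) * shiftedKernel x δ τ u -
        x * (Complex.sinh (u + δ * Complex.I) * shiftedKernel x δ τ u)) u := by
  have h1 : HasDerivAt (fun v : ℝ => (v : ℂ) + δ * Complex.I) 1 u :=
    (Complex.ofRealCLM.hasDerivAt (x := u)).add_const _
  have h2 := ((((Complex.hasDerivAt_cosh _).comp u h1).const_mul (-(x : ℂ))).cexp).mul
    ((((Complex.ofRealCLM.hasDerivAt (x := u)).const_mul (τ : ℂ)).mul_const Complex.I).cexp)
  refine h2.congr_deriv ?_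
  simp [shiftedKernel]
  ring

lemma integral_sinh_mul_shiftedKernel {x δ : ℝ} (h : 0 < x * Real.cos δ) (τ : ℝ) :
    x * ∫ u : ℝ, Complex.sinh (u + δ * Complex.I) * shiftedKernel x δ τ u =
      τ * Complex.I * ∫ u : ℝ, shiftedKernel x δ τ u := by
  have h1 := (integrable_shiftedKernel h τ).const_mul (τ * Complex.I)
  have h2 := (integrable_sinh_mul_shiftedKernel h τ).const_mul (x : ℂ)
  have := integral_eq_zero_of_hasDerivAt_of_integrable (hasDerivAt_shiftedKernel x δ τ)
    (h1.sub h2) (integrable_shiftedKernel h τ)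
  rw [integral_sub h1 h2, integral_const_mul, integral_const_mul, sub_eq_zero] at this
  exact this.symm

lemma hasDerivAt_shiftedKernel_height (x δ τ u : ℝ) :
    HasDerivAt (fun δ => shiftedKernel x δ τ u)
      (-x * Complex.I * (Complex.sinh (u + δ * Complex.I) * shiftedKernel x δ τ u)) δ := by
  have h1 : HasDerivAt (fun v : ℝ => (u : ℂ) + v * Complex.I) Complex.I δ := by
    simpa using ((Complex.ofRealCLM.hasDerivAt (x := δ)).mul_const Complex.I).const_add (u : ℂ)
  have h2 := ((((Complex.hasDerivAt_cosh _).comp δ h1).const_mul (-(x : ℂ))).cexp).mul_const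
    (Complex.exp (τ * u * Complex.I))
  refine h2.congr_deriv ?_
  simp [shiftedKernel]
  ring

lemma cos_pos_of_abs_lt {δ : ℝ} (h : |δ| < π / 2) : 0 < Real.cos δ :=
  Real.cos_pos_of_mem_Ioo (abs_lt.1 h)

lemma hasDerivAt_integral_shiftedKernel {x δ : ℝ} (hx : 0 < x) (hδ : |δ| < π / 2) (τ : ℝ) :
    HasDerivAt (fun δ => ∫ u, shiftedKernel x δ τ u)
      (τ * ∫ u, shiftedKernel x δ τ u) δ := by
  obtain ⟨d, hd, hd'⟩ := exists_between hδ
  have hd0 : 0 ≤ d := (abs_nonneg δ).trans hd.le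
  have hc : 0 < Real.cos d := cos_pos_of_abs_lt (by rwa [abs_of_nonneg hd0])
  have key := (hasDerivAt_integral_of_dominated_loc_of_deriv_le (μ := volume)
    (F := fun δ u => shiftedKernel x δ τ u) (x₀ := δ) (s := Ioo (-d) d)
    (F' := fun δ u => -x * Complex.I * (Complex.sinh (u + δ * Complex.I) * shiftedKernel x δ τ u))
    (bound := fun u => x * (Real.cosh u * Real.exp (-(x * Real.cos d * Real.cosh u))))
    (Ioo_mem_nhds (by linarith [(abs_lt.1 hd).1]) (abs_lt.1 hd).2)
    (.of_forall fun δ => (continuous_shiftedKernel x δ τ).aestronglyMeasurable)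
    (integrable_shiftedKernel (mul_pos hx (cos_pos_of_abs_lt hδ)) τ)
    ((integrable_sinh_mul_shiftedKernel (mul_pos hx (cos_pos_of_abs_lt hδ)) τ).const_mul
      _).aestronglyMeasurable
    (.of_forall fun u e he => ?_)
    ((integrable_cosh_mul_exp_neg_mul_cosh (mul_pos hx hc)).const_mul x)
    (.of_forall fun u e _ => hasDerivAt_shiftedKernel_height x e τ u)).2
  · refine key.congr_deriv ?_
    rw [integral_const_mul]
    linear_combination (-Complex.I) *
      integral_sinh_mul_shiftedKernel (mul_pos hx (cos_pos_of_abs_lt hδ)) τ -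
      (τ * ∫ u, shiftedKernel x δ τ u) * Complex.I_sq
  · have hcos : Real.cos d ≤ Real.cos e := by
      rw [← Real.cos_abs e]
      exact Real.cos_le_cos_of_nonneg_of_le_pi (abs_nonneg e) (by linarith [Real.pi_pos])
        (abs_lt.2 he).le
    rw [norm_mul, norm_mul, norm_neg, Complex.norm_I, Complex.norm_real, norm_mul,
      norm_shiftedKernel, Real.norm_of_nonneg hx.le, mul_one]
    have := Real.cosh_pos u
    gcongr
    exact norm_sinh_add_mul_I_le u e

lemma integral_shiftedKernel {x δ : ℝ} (hx : 0 < x) (hδ : |δ| < π / 2) (τ : ℝ) :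
    ∫ u, shiftedKernel x δ τ u = Real.exp (δ * τ) * ∫ u, shiftedKernel x 0 τ u := by
  set J : ℝ → ℂ := fun δ => Complex.exp (-(δ * τ)) * ∫ u, shiftedKernel x δ τ u with hJ
  have hd : ∀ e ∈ Ioo (-(π / 2)) (π / 2), HasDerivAt J 0 e := by
    intro e he
    have h1 := ((((Complex.ofRealCLM.hasDerivAt (x := e)).mul_const (τ : ℂ)).neg).cexp).mul
      (hasDerivAt_integral_shiftedKernel hx (abs_lt.2 he) τ)
    refine HasDerivAt.congr_deriv (f := J) h1 ?_
    simp
    ring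
  have hconst := isOpen_Ioo.is_const_of_deriv_eq_zero isPreconnected_Ioo
    (fun e he => (hd e he).differentiableAt.differentiableWithinAt)
    (fun e he => (hd e he).deriv) (abs_lt.1 hδ)
    (show (0 : ℝ) ∈ Ioo (-(π / 2)) (π / 2) by constructor <;> linarith [Real.pi_pos])
  simp only [hJ, Complex.ofReal_zero, zero_mul, neg_zero, Complex.exp_zero, one_mul] at hconst
  rw [← hconst, ← mul_assoc, Complex.ofReal_exp, ← Complex.exp_add]
  simp

lemma integral_eq_integral_Ioi_add_comp_neg {g : ℝ → ℂ} (hg : Integrable g) :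
    ∫ u, g u = ∫ u in Ioi 0, (g u + g (-u)) := by
  rw [integral_add hg.integrableOn hg.comp_neg.integrableOn,
    integral_comp_neg_Ioi, neg_zero, add_comm,
    ← setIntegral_univ, ← Iic_union_Ioi (a := (0:ℝ)),
    setIntegral_union (Iic_disjoint_Ioi le_rfl) measurableSet_Ioi hg.integrableOn hg.integrableOn]

lemma Kib_eq_integral {x : ℝ} (hx : 0 < x) (τ : ℝ) :
    (Kib τ x : ℂ) = 1 / 2 * ∫ u, shiftedKernel x 0 τ u := by
  rw [integral_eq_integral_Ioi_add_comp_neg (integrable_shiftedKernel (by simpa) τ), Kib,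
    ← integral_complex_ofReal, ← integral_const_mul]
  congr 1
  ext u
  simp only [shiftedKernel, Complex.ofReal_zero, zero_mul, add_zero, Complex.ofReal_neg,
    Complex.cosh_neg, ← mul_add, Complex.ofReal_mul, Complex.ofReal_exp, Complex.ofReal_cosh,
    Complex.ofReal_cos, Complex.cos]
  ring_nf

lemma exp_mul_Kib {x δ : ℝ} (hx : 0 < x) (hδ : |δ| < π / 2) (τ : ℝ) :
    (Real.exp (δ * τ) : ℂ) * Kib τ x = 1 / 2 * ∫ u, shiftedKernel x δ τ u := by
  rw [integral_shiftedKernel hx hδ, Kib_eq_integral hx]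
  ring

lemma Kib_neg (τ x : ℝ) : Kib (-τ) x = Kib τ x := by
  simp [Kib]

lemma Kib_zero (x : ℝ) : Kib 0 x = K0 x := by
  simp [Kib, K0]

lemma K0_nonneg (x : ℝ) : 0 ≤ K0 x := integral_nonneg fun _ => (Real.exp_pos _).le

lemma integral_exp_neg_mul_cosh {x : ℝ} (hx : 0 < x) :
    ∫ u, Real.exp (-(x * Real.cosh u)) = 2 * K0 x := by
  have h := Kib_eq_integral hx 0
  rw [Kib_zero] at h
  have h2 : ∫ u, shiftedKernel x 0 0 u = ((∫ u, Real.exp (-(x * Real.cosh u)) : ℝ) : ℂ) := by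
    rw [← integral_complex_ofReal]
    congr 1
    ext u
    simp [shiftedKernel]
  rw [h2] at h
  have h3 : (2 : ℂ) * K0 x = ((∫ u, Real.exp (-(x * Real.cosh u)) : ℝ) : ℂ) := by
    rw [h]; ring
  exact_mod_cast h3.symm

lemma abs_Kib_le {x δ : ℝ} (hx : 0 < x) (hδ0 : 0 ≤ δ) (hδ : δ < π / 2) (τ : ℝ) :
    |Kib τ x| ≤ Real.exp (-(δ * |τ|)) * K0 (x * Real.cos δ) := by
  wlog hτ : 0 ≤ τ generalizing τ
  · simpa [Kib_neg] using this (-τ) (by linarith)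
  have hδ' : |δ| < π / 2 := by rwa [abs_of_nonneg hδ0]
  have h := congrArg norm (exp_mul_Kib hx hδ' τ)
  have h2 : ‖∫ u, shiftedKernel x δ τ u‖ ≤ 2 * K0 (x * Real.cos δ) := by
    rw [← integral_exp_neg_mul_cosh (mul_pos hx (cos_pos_of_abs_lt hδ'))]
    refine (norm_integral_le_integral_norm _).trans_eq ?_
    simp_rw [norm_shiftedKernel]
  rw [norm_mul, norm_mul, Complex.norm_real, Complex.norm_real, Real.norm_eq_abs, Real.norm_eq_abs,
    Real.abs_exp] at h
  rw [abs_of_nonneg hτ, Real.exp_neg, ← div_eq_inv_mul, le_div_iff₀ (Real.exp_pos _), mul_comm, h]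
  norm_num
  linarith

/-- The function `w ↦ exp (-A/w - Bw)`. -/
noncomputable def macdonaldWeight (A B w : ℝ) : ℝ := Real.exp (-(A / w) - B * w)

/-- The Laplace transform of `macdonaldWeight A B`. -/
noncomputable def macdonaldLaplace (A B : ℝ) (z : ℂ) : ℂ :=
  ∫ w in Ioi (0 : ℝ), Complex.exp (-(w * z)) * macdonaldWeight A B w

lemma macdonaldWeight_pos (A B w : ℝ) : 0 < macdonaldWeight A B w := Real.exp_pos _

@[fun_prop]
lemma measurable_macdonaldWeight (A B : ℝ) : Measurable (macdonaldWeight A B) := by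
  unfold macdonaldWeight; fun_prop

lemma macdonaldWeight_div_pow_le {A w : ℝ} (hA : 0 < A) (hw : 0 < w) (B : ℝ) (n : ℕ) :
    macdonaldWeight A B w / w ^ n ≤ n.factorial / A ^ n * Real.exp (-B * w) := by
  have h := exp_neg_le_factorial_div_pow (div_pos hA hw) n
  rw [div_le_iff₀ (by positivity), macdonaldWeight, sub_eq_add_neg, Real.exp_add, ← neg_mul]
  calc _ ≤ n.factorial / (A / w) ^ n * Real.exp (-B * w) := by gcongr
    _ = _ := by rw [div_pow]; field_simp

lemma integrableOn_exp_neg_mul {B : ℝ} (hB : 0 < B) :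
    IntegrableOn (fun w => Real.exp (-B * w)) (Ioi 0) :=
  integrableOn_exp_mul_Ioi (by linarith) 0

lemma integrableOn_macdonaldWeight_div_pow {A B : ℝ} (hA : 0 < A) (hB : 0 < B) (n : ℕ) :
    IntegrableOn (fun w => macdonaldWeight A B w / w ^ n) (Ioi 0) := by
  refine ((integrableOn_exp_neg_mul hB).const_mul (n.factorial / A ^ n)).mono'
    ((measurable_macdonaldWeight A B).div (by fun_prop)).aestronglyMeasurable ?_
  filter_upwards [ae_restrict_mem measurableSet_Ioi] with w (hw : 0 < w)
  rw [Real.norm_of_nonneg (div_nonneg (macdonaldWeight_pos A B w).le (by positivity))]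
  exact macdonaldWeight_div_pow_le hA hw B n

lemma integrableOn_macdonaldWeight {A B : ℝ} (hA : 0 < A) (hB : 0 < B) :
    IntegrableOn (macdonaldWeight A B) (Ioi 0) := by
  simpa using integrableOn_macdonaldWeight_div_pow hA hB 0

lemma norm_exp_neg_mul_le_one {w : ℝ} (hw : 0 < w) {z : ℂ} (hz : 0 ≤ z.re) :
    ‖Complex.exp (-(w * z))‖ ≤ 1 := by
  rw [Complex.norm_exp, Real.exp_le_one_iff, Complex.neg_re, Complex.re_ofReal_mul]
  nlinarith

lemma norm_exp_mul_macdonaldWeight_le (A B : ℝ) {w : ℝ} (hw : 0 < w) {z : ℂ} (hz : 0 ≤ z.re) :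
    ‖Complex.exp (-(w * z)) * macdonaldWeight A B w‖ ≤ macdonaldWeight A B w := by
  rw [norm_mul, Complex.norm_real, Real.norm_of_nonneg (macdonaldWeight_pos A B w).le]
  exact mul_le_of_le_one_left (macdonaldWeight_pos A B w).le (norm_exp_neg_mul_le_one hw hz)

lemma integrableOn_exp_mul_macdonaldWeight {A B : ℝ} (hA : 0 < A) (hB : 0 < B) {z : ℂ}
    (hz : 0 ≤ z.re) :
    IntegrableOn (fun w : ℝ => Complex.exp (-(w * z)) * macdonaldWeight A B w) (Ioi 0) := by
  refine (integrableOn_macdonaldWeight hA hB).mono' (by fun_prop) ?_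
  filter_upwards [ae_restrict_mem measurableSet_Ioi] with w hw
  exact norm_exp_mul_macdonaldWeight_le A B hw hz

lemma continuousOn_macdonaldLaplace {A B : ℝ} (hA : 0 < A) (hB : 0 < B) :
    ContinuousOn (macdonaldLaplace A B) {z | 0 ≤ z.re} := by
  refine continuousOn_of_dominated (bound := macdonaldWeight A B) (fun z _ => by fun_prop)
    (fun z hz => ?_) (integrableOn_macdonaldWeight hA hB) (.of_forall fun w => by fun_prop)
  filter_upwards [ae_restrict_mem measurableSet_Ioi] with w hw
  exact norm_exp_mul_macdonaldWeight_le A B hw hz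

lemma hasDerivAt_macdonaldWeight (A B : ℝ) {w : ℝ} (hw : 0 < w) :
    HasDerivAt (macdonaldWeight A B) ((A / w ^ 2 - B) * macdonaldWeight A B w) w := by
  have h := (((hasDerivAt_inv hw.ne').const_mul A).neg.sub
    ((hasDerivAt_id w).const_mul B)).exp
  refine (h.congr_deriv ?_).congr_of_eventuallyEq (.of_forall fun v => ?_)
  · simp [macdonaldWeight, div_eq_mul_inv]; ring
  · simp [macdonaldWeight, div_eq_mul_inv]

lemma tendsto_macdonaldWeight_div_pow_nhdsGT {A B : ℝ} (hA : 0 < A) (n : ℕ) :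
    Tendsto (fun w => macdonaldWeight A B w / w ^ n) (𝓝[>] 0) (𝓝 0) := by
  have h : Tendsto (fun w => ((n + 1).factorial / A ^ (n + 1) * Real.exp (-B * w)) * w)
      (𝓝[>] 0) (𝓝 0) :=
    tendsto_nhdsWithin_of_tendsto_nhds (Continuous.tendsto' (by fun_prop) _ _ (by simp))
  refine squeeze_zero' ?_ ?_ h
  · filter_upwards [self_mem_nhdsWithin] with w (hw : 0 < w)
    exact div_nonneg (macdonaldWeight_pos A B w).le (by positivity)
  · filter_upwards [self_mem_nhdsWithin] with w (hw : 0 < w)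
    have := mul_le_mul_of_nonneg_right (macdonaldWeight_div_pow_le hA hw B (n + 1)) hw.le
    refine le_trans (le_of_eq ?_) this
    rw [pow_succ]
    field_simp

lemma tendsto_macdonaldWeight_div_pow_atTop {A B : ℝ} (hA : 0 < A) (hB : 0 < B) (n : ℕ) :
    Tendsto (fun w => macdonaldWeight A B w / w ^ n) atTop (𝓝 0) := by
  have h : Tendsto (fun w => n.factorial / A ^ n * Real.exp (-B * w)) atTop (𝓝 0) := by
    have h1 : Tendsto (fun w : ℝ => -B * w) atTop atBot :=
      tendsto_id.const_mul_atTop_of_neg (by linarith)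
    simpa using (Real.tendsto_exp_atBot.comp h1).const_mul (n.factorial / A ^ n)
  refine squeeze_zero' ?_ ?_ h
  · filter_upwards [Ioi_mem_atTop 0] with w (hw : 0 < w)
    exact div_nonneg (macdonaldWeight_pos A B w).le (by positivity)
  · filter_upwards [Ioi_mem_atTop 0] with w hw
    exact macdonaldWeight_div_pow_le hA hw B n

lemma integrableOn_deriv_deriv_macdonaldWeight {A B : ℝ} (hA : 0 < A) (hB : 0 < B) :
    IntegrableOn (fun w => ((A / w ^ 2 - B) ^ 2 - 2 * A / w ^ 3) * macdonaldWeight A B w)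
      (Ioi 0) := by
  have h n := integrableOn_macdonaldWeight_div_pow hA hB n
  refine IntegrableOn.congr_fun ((((h 4).const_mul (A ^ 2)).sub ((h 2).const_mul (2 * A * B))).add
    (((h 0).const_mul (B ^ 2)).sub ((h 3).const_mul (2 * A)))) (fun w (hw : 0 < w) => ?_)
    measurableSet_Ioi
  simp only [Pi.add_apply, Pi.sub_apply]
  field_simp
  ring

lemma norm_exp_mul_deriv_deriv_macdonaldWeight_le (A B : ℝ) {w : ℝ} (hw : 0 < w) {z : ℂ}
    (hz : 0 ≤ z.re) :
    ‖Complex.exp (-(w * z)) *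
      (((A / w ^ 2 - B) ^ 2 - 2 * A / w ^ 3) * macdonaldWeight A B w : ℝ)‖ ≤
      |((A / w ^ 2 - B) ^ 2 - 2 * A / w ^ 3) * macdonaldWeight A B w| := by
  rw [norm_mul, Complex.norm_real, Real.norm_eq_abs]
  exact mul_le_of_le_one_left (abs_nonneg _) (norm_exp_neg_mul_le_one hw hz)

lemma macdonaldLaplace_integration_by_parts {A B : ℝ} (hA : 0 < A) (hB : 0 < B) {z : ℂ}
    (hz : 0 ≤ z.re) :
    z ^ 2 * macdonaldLaplace A B z = ∫ w in Ioi (0 : ℝ), Complex.exp (-(w * z)) *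
      (((A / w ^ 2 - B) ^ 2 - 2 * A / w ^ 3) * macdonaldWeight A B w : ℝ) := by
  set G : ℝ → ℂ := fun w => Complex.exp (-(w * z)) *
    ((z + (A / w ^ 2 - B : ℝ)) * macdonaldWeight A B w) with hG
  have hderiv : ∀ w ∈ Ioi (0 : ℝ), HasDerivAt G (Complex.exp (-(w * z)) *
      (((A / w ^ 2 - B) ^ 2 - 2 * A / w ^ 3) * macdonaldWeight A B w : ℝ) -
      z ^ 2 * (Complex.exp (-(w * z)) * macdonaldWeight A B w)) w := by
    intro w (hw : 0 < w)
    have h1 := (((Complex.ofRealCLM.hasDerivAt (x := w)).mul_const z).neg).cexp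
    have h2 : HasDerivAt (fun w : ℝ => A / w ^ 2 - B) (-(2 * A / w ^ 3)) w := by
      have := (((hasDerivAt_pow 2 w).inv (by positivity)).const_mul A).sub_const B
      refine (this.congr_deriv ?_).congr_of_eventuallyEq (.of_forall fun v => ?_)
      · field_simp; norm_num; ring
      · simp [div_eq_mul_inv]
    have h3 := h1.mul ((h2.ofReal_comp.const_add z).mul
      (hasDerivAt_macdonaldWeight A B hw).ofReal_comp)
    refine HasDerivAt.congr_deriv (f := G) h3 ?_
    simp
    ring
  have hbound : ∀ w ∈ Ioi (0 : ℝ), ‖G w‖ ≤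
      (‖z‖ + B) * (macdonaldWeight A B w / w ^ 0) + A * (macdonaldWeight A B w / w ^ 2) := by
    intro w (hw : 0 < w)
    have hm := macdonaldWeight_pos A B w
    rw [hG, norm_mul, norm_mul, Complex.norm_real, Real.norm_of_nonneg hm.le]
    refine (mul_le_of_le_one_left (by positivity) (norm_exp_neg_mul_le_one hw hz)).trans ?_
    have h1 : ‖z + (A / w ^ 2 - B : ℝ)‖ ≤ ‖z‖ + (A / w ^ 2 + B) := by
      refine (norm_add_le _ _).trans ?_
      gcongr
      rw [Complex.norm_real, Real.norm_eq_abs]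
      refine (abs_sub _ _).trans_eq ?_
      rw [abs_of_pos hB, abs_of_nonneg (by positivity)]
    refine (mul_le_mul_of_nonneg_right h1 hm.le).trans_eq ?_
    field_simp
    ring
  have hlim {l : Filter ℝ} (hl : Ioi (0 : ℝ) ∈ l)
      (h : ∀ n : ℕ, Tendsto (fun w => macdonaldWeight A B w / w ^ n) l (𝓝 0)) :
      Tendsto G l (𝓝 0) := by
    have h1 := ((h 0).const_mul (‖z‖ + B)).add ((h 2).const_mul A)
    rw [mul_zero, mul_zero, add_zero] at h1
    exact squeeze_zero_norm' (Filter.mem_of_superset hl hbound) h1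
  have hint1 : IntegrableOn (fun w : ℝ => Complex.exp (-(w * z)) *
      (((A / w ^ 2 - B) ^ 2 - 2 * A / w ^ 3) * macdonaldWeight A B w : ℝ)) (Ioi 0) := by
    refine Integrable.mono' (integrableOn_deriv_deriv_macdonaldWeight hA hB).abs
      (((by fun_prop : Continuous fun w : ℝ => Complex.exp (-(w * z))).aestronglyMeasurable).mul
      (integrableOn_deriv_deriv_macdonaldWeight hA hB).ofReal.aestronglyMeasurable) ?_
    filter_upwards [ae_restrict_mem measurableSet_Ioi] with w hw
    exact norm_exp_mul_deriv_deriv_macdonaldWeight_le A B hw hz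
  have hint2 := (integrableOn_exp_mul_macdonaldWeight hA hB hz).const_mul (z ^ 2)
  have hone := integral_Ioi_deriv_mul_eq_sub (a := 0) (a' := (0 : ℂ)) (b' := 0)
    (u := fun _ => (1 : ℂ)) (u' := fun _ => 0)
    (fun w _ => hasDerivAt_const w 1) hderiv
    (by simpa [Pi.mul_def, Pi.add_def, Pi.sub_def] using hint1.sub hint2)
    (by simpa [Pi.mul_def] using
      hlim self_mem_nhdsWithin (tendsto_macdonaldWeight_div_pow_nhdsGT hA))
    (by simpa [Pi.mul_def] using
      hlim (Ioi_mem_atTop 0) (tendsto_macdonaldWeight_div_pow_atTop hA hB))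
  simp only [zero_mul, one_mul, zero_add, sub_zero] at hone
  rw [integral_sub hint1 hint2, integral_const_mul, sub_eq_zero] at hone
  exact hone.symm

lemma exists_macdonaldLaplace_bound {A B : ℝ} (hA : 0 < A) (hB : 0 < B) :
    ∃ C, ∀ z : ℂ, 0 ≤ z.re → ‖macdonaldLaplace A B z‖ ≤ C / (1 + ‖z‖ ^ 2) := by
  refine ⟨(∫ w in Ioi (0 : ℝ), macdonaldWeight A B w) +
    ∫ w in Ioi (0 : ℝ), |((A / w ^ 2 - B) ^ 2 - 2 * A / w ^ 3) * macdonaldWeight A B w|,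
    fun z hz => ?_⟩
  rw [le_div_iff₀ (by positivity), mul_add, mul_one]
  refine add_le_add (norm_integral_le_of_norm_le (integrableOn_macdonaldWeight hA hB) ?_) ?_
  · filter_upwards [ae_restrict_mem measurableSet_Ioi] with w hw
    exact norm_exp_mul_macdonaldWeight_le A B hw hz
  · rw [mul_comm, ← norm_pow, ← norm_mul, macdonaldLaplace_integration_by_parts hA hB hz]
    refine norm_integral_le_of_norm_le (integrableOn_deriv_deriv_macdonaldWeight hA hB).abs ?_
    filter_upwards [ae_restrict_mem measurableSet_Ioi] with w hw
    exact norm_exp_mul_deriv_deriv_macdonaldWeight_le A B hw hz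

lemma integral_fourier_inversion {f : ℝ → ℂ} (hf : Integrable f)
    (hF : Integrable fun τ : ℝ => ∫ s : ℝ, Complex.exp (τ * s * Complex.I) * f s) {u : ℝ}
    (hu : ContinuousAt f u) :
    ∫ τ : ℝ, Complex.exp (-(τ * u * Complex.I)) *
      ∫ s : ℝ, Complex.exp (τ * s * Complex.I) * f s = 2 * π * f u := by
  set F : ℝ → ℂ := fun τ => ∫ s : ℝ, Complex.exp (τ * s * Complex.I) * f s with hFdef
  have h𝓕 : (FourierTransform.fourier f : ℝ → ℂ) = fun ξ => F (-(2 * π) * ξ) := by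
    ext ξ
    rw [Real.fourier_eq']
    simp only [hFdef]
    congr 1
    ext s
    simp only [smul_eq_mul, RCLike.inner_apply, conj_trivial]
    push_cast
    ring_nf
  have hpi : (-(2 * π)) ≠ 0 := by have := Real.pi_pos; linarith
  have h1 := hf.fourierInv_fourier_eq (by rw [h𝓕]; exact hF.comp_mul_left' hpi) hu
  rw [h𝓕, Real.fourierInv_eq'] at h1
  have h2 := Measure.integral_comp_mul_left
    (fun τ : ℝ => Complex.exp (-(τ * u * Complex.I)) * F τ) (-(2 * π))
  rw [← h1]
  have h3 : ∫ ξ : ℝ, Complex.exp (-(((-(2 * π) * ξ : ℝ) : ℂ) * u * Complex.I)) * F (-(2 * π) * ξ) =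
      ∫ ξ : ℝ, Complex.exp (((2 * π * inner ℝ ξ u : ℝ) : ℂ) * Complex.I) • F (-(2 * π) * ξ) := by
    congr 1
    ext ξ
    simp only [smul_eq_mul, RCLike.inner_apply, conj_trivial]
    push_cast
    ring_nf
  rw [← h3, h2, abs_of_nonpos (by rw [inv_nonpos]; linarith [Real.pi_pos]), Complex.real_smul]
  have h4 : ((-(-(2 * π))⁻¹ : ℝ) : ℂ) = (2 * (π : ℂ))⁻¹ := by push_cast; rw [inv_neg, neg_neg]
  rw [h4, mul_inv_cancel_left₀ (by simp)]

lemma integrable_prod_Ioi_of_norm_le {F : ℝ × ℝ → ℂ} {a b : ℝ → ℝ}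
    (hF : Measurable F) (ha : Integrable a) (hb : IntegrableOn b (Ioi 0))
    (h : ∀ s, ∀ w, 0 < w → ‖F (s, w)‖ ≤ a s * b w) :
    Integrable F (volume.prod (volume.restrict (Ioi 0))) := by
  refine (ha.mul_prod hb).mono' hF.aestronglyMeasurable ?_
  have h1 : ∀ᵐ q : ℝ × ℝ ∂(volume.prod (volume.restrict (Ioi 0))), q.2 ∈ Ioi (0 : ℝ) :=
    Measure.quasiMeasurePreserving_snd.ae (ae_restrict_mem measurableSet_Ioi)
  filter_upwards [h1] with q hq using h q.1 q.2 hq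

lemma measurable_shiftedKernel_prod (δ τ : ℝ) :
    Measurable (fun q : ℝ × ℝ => shiftedKernel q.2 δ τ q.1) := by
  unfold shiftedKernel; fun_prop

lemma integral_shiftedKernel_mul_comp_sub {x y : ℝ} (hx : 0 < x) (hy : 0 < y) (τ s : ℝ) :
    ∫ a, shiftedKernel x 0 τ a * shiftedKernel y 0 τ (s - a) =
      ∫ w in Ioi (0 : ℝ), (macdonaldWeight (x * y / 2) ((x / y + y / x) / 2) w / w : ℝ) *
        shiftedKernel w 0 τ s := by
  set c : ℝ := x * y / (x + y * Real.exp s) with hc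
  have hs := Real.exp_pos s
  have hc0 : 0 < c := by positivity
  have himage : (fun a => c * Real.exp a) '' univ = Ioi 0 := by
    ext w
    simp only [image_univ, mem_range, mem_Ioi]
    refine ⟨?_, fun hw => ⟨Real.log (w / c), ?_⟩⟩
    · rintro ⟨a, rfl⟩; positivity
    · rw [Real.exp_log (by positivity)]; field_simp
  rw [← himage, integral_image_eq_integral_abs_deriv_smul MeasurableSet.univ
    (fun a _ => ((Real.hasDerivAt_exp a).const_mul c).hasDerivWithinAt)
    (fun a _ b _ h => Real.exp_injective (mul_left_cancel₀ hc0.ne' h)), setIntegral_univ]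
  congr 1
  ext a
  have ha := Real.exp_pos a
  have hexp : -(x * Real.cosh a) + -(y * Real.cosh (s - a)) =
      -(x * y / 2 / (c * Real.exp a)) - (x / y + y / x) / 2 * (c * Real.exp a) +
        -(c * Real.exp a * Real.cosh s) := by
    rw [Real.cosh_eq, Real.cosh_eq, Real.cosh_eq, neg_sub, Real.exp_sub, Real.exp_sub, Real.exp_neg,
      Real.exp_neg, hc]
    field_simp
    ring
  have hker (w r : ℝ) : shiftedKernel w 0 τ r =
      Real.exp (-(w * Real.cosh r)) * Complex.exp (τ * r * Complex.I) := by
    simp [shiftedKernel]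
  have hcancel (M : ℝ) (Z : ℂ) :
      ((c * Real.exp a : ℝ) : ℂ) * (((M / (c * Real.exp a) : ℝ) : ℂ) * Z) =
      M * Z := by
    rw [← mul_assoc, ← Complex.ofReal_mul, mul_div_cancel₀ _ (by positivity)]
  have hprod (a b : ℝ) : (Real.exp a : ℂ) * Real.exp b = (Real.exp (a + b) : ℝ) := by
    rw [Real.exp_add, Complex.ofReal_mul]
  rw [abs_of_pos (by positivity), hker, hker, hker, macdonaldWeight, Complex.real_smul, hcancel,
    mul_mul_mul_comm, ← Complex.exp_add, ← mul_assoc, hprod, hprod, hexp]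
  push_cast
  ring_nf

open Convolution in
/-- Macdonald's formula for the product of two modified Bessel functions of imaginary order. -/
lemma Kib_mul_Kib {x y : ℝ} (hx : 0 < x) (hy : 0 < y) (τ : ℝ) :
    (Kib τ x : ℂ) * Kib τ y = 1 / 2 * ∫ w in Ioi (0 : ℝ),
      (macdonaldWeight (x * y / 2) ((x / y + y / x) / 2) w / w : ℝ) * (Kib τ w : ℂ) := by
  set m := macdonaldWeight (x * y / 2) ((x / y + y / x) / 2) with hm
  have hconv := integral_convolution (μ := volume) (ν := volume) (ContinuousLinearMap.mul ℂ ℂ)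
    (integrable_shiftedKernel (x := x) (δ := 0) (by simpa) τ)
    (integrable_shiftedKernel (x := y) (δ := 0) (by simpa) τ)
  simp only [convolution_def, ContinuousLinearMap.mul_apply'] at hconv
  simp_rw [integral_shiftedKernel_mul_comp_sub hx hy] at hconv
  rw [integral_integral_swap] at hconv
  · rw [Kib_eq_integral hx, Kib_eq_integral hy, mul_mul_mul_comm, ← hconv]
    have : ∫ w in Ioi (0 : ℝ), ((m w / w : ℝ) : ℂ) * (Kib τ w : ℂ) =
        ∫ w in Ioi (0 : ℝ), 1 / 2 * ∫ s, ((m w / w : ℝ) : ℂ) * shiftedKernel w 0 τ s :=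
      setIntegral_congr_fun measurableSet_Ioi fun w hw => by
        rw [Kib_eq_integral hw, integral_const_mul]
        ring
    rw [this, integral_const_mul]
    ring
  · refine integrable_prod_Ioi_of_norm_le (b := fun w => m w / w ^ 2) ?_ integrable_inv_cosh
      (integrableOn_macdonaldWeight_div_pow (by positivity) (by positivity) 2) ?_
    · have := measurable_shiftedKernel_prod 0 τ
      have h2 := measurable_macdonaldWeight (x * y / 2) ((x / y + y / x) / 2)
      simp only [Function.uncurry_def]
      fun_prop
    · intro s w hw
      have hmw : 0 < m w := macdonaldWeight_pos _ _ _
      have h := exp_neg_mul_cosh_le hw s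
      rw [Function.uncurry_apply_pair, norm_mul, norm_shiftedKernel, Complex.norm_real,
        Real.norm_of_nonneg (by positivity), Real.cos_zero, mul_one]
      calc _ ≤ m w / w * (w⁻¹ * (Real.cosh s)⁻¹) := by gcongr
        _ = _ := by field_simp

/-- The function whose Fourier transform is, up to a constant, `τ e^{δτ} K_{iτ}(x) K_{iτ}(y)`. -/
noncomputable def laplaceOnLine (A B δ s : ℝ) : ℂ :=
  Complex.sinh (s + δ * Complex.I) * macdonaldLaplace A B (Complex.cosh (s + δ * Complex.I))

lemma mul_exp_mul_Kib_mul_Kib {x y δ : ℝ} (hx : 0 < x) (hy : 0 < y) (hδ : |δ| < π / 2) (τ : ℝ) :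
    (τ * Real.exp (δ * τ) : ℂ) * (Kib τ x * Kib τ y) = -(Complex.I / 4) *
      ∫ s : ℝ, Complex.exp (τ * s * Complex.I) *
        laplaceOnLine (x * y / 2) ((x / y + y / x) / 2) δ s := by
  set m := macdonaldWeight (x * y / 2) ((x / y + y / x) / 2) with hm
  have hcos := cos_pos_of_abs_lt hδ
  have h1 : (τ * Real.exp (δ * τ) : ℂ) * (Kib τ x * Kib τ y) = -(Complex.I / 4) *
      ∫ w in Ioi (0 : ℝ), ∫ s : ℝ,
        (m w : ℂ) * (Complex.sinh (s + δ * Complex.I) * shiftedKernel w δ τ s) := by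
    rw [Kib_mul_Kib hx hy, ← hm, mul_left_comm, ← integral_const_mul, ← integral_const_mul,
      ← integral_const_mul]
    refine setIntegral_congr_fun measurableSet_Ioi fun w (hw : 0 < w) => ?_
    have hw' : (w : ℂ) ≠ 0 := by exact_mod_cast hw.ne'
    have e1 := exp_mul_Kib hw hδ τ
    have e2 := integral_sinh_mul_shiftedKernel (mul_pos hw hcos) τ
    rw [integral_const_mul]
    have e3 : (∫ u : ℝ, Complex.sinh (u + δ * Complex.I) * shiftedKernel w δ τ u) =
        τ * Complex.I * (∫ u : ℝ, shiftedKernel w δ τ u) / w := by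
      rw [← e2]; field_simp
    have e4 : (∫ u : ℝ, shiftedKernel w δ τ u) = 2 * (Real.exp (δ * τ) * Kib τ w) := by
      rw [e1]; ring
    rw [e3, e4]
    push_cast
    field_simp
    linear_combination (4 * (m w : ℂ) * Kib τ w * τ) * Complex.I_sq
  rw [h1, ← integral_integral_swap]
  · congr 2
    ext s
    rw [laplaceOnLine, macdonaldLaplace, ← mul_assoc, ← integral_const_mul]
    congr 1
    ext w
    rw [shiftedKernel, hm, neg_mul]
    ring
  · refine integrable_prod_Ioi_of_norm_le (b := fun w => 2 / (Real.cos δ) ^ 2 * (m w / w ^ 2)) ?_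
      integrable_inv_cosh
      ((integrableOn_macdonaldWeight_div_pow (by positivity) (by positivity) 2).const_mul _) ?_
    · have := measurable_shiftedKernel_prod δ τ
      have h2 := measurable_macdonaldWeight (x * y / 2) ((x / y + y / x) / 2)
      simp only [Function.uncurry_def]
      fun_prop
    · intro s w hw
      have hmw : 0 < m w := macdonaldWeight_pos _ _ _
      have h := cosh_mul_exp_neg_mul_cosh_le (mul_pos hw hcos) s
      have h2 := norm_sinh_add_mul_I_le s δ
      have := Real.cosh_pos s
      rw [Function.uncurry_apply_pair, norm_mul, norm_mul, norm_shiftedKernel, Complex.norm_real,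
        Real.norm_of_nonneg hmw.le]
      calc _ ≤ m w * (Real.cosh s * Real.exp (-(w * Real.cos δ * Real.cosh s))) := by gcongr
        _ ≤ m w * (2 * (w * Real.cos δ)⁻¹ ^ 2 * (Real.cosh s)⁻¹) := by gcongr
        _ = _ := by field_simp

lemma norm_cosh_add_mul_I_sq (u δ : ℝ) :
    ‖Complex.cosh (u + δ * Complex.I)‖ ^ 2 = Real.sinh u ^ 2 + Real.cos δ ^ 2 := by
  rw [Complex.cosh_add, Complex.cosh_mul_I, Complex.sinh_mul_I, ← Complex.ofReal_cosh,
    ← Complex.ofReal_cos, ← Complex.ofReal_sin, ← Complex.ofReal_sinh, Complex.sq_norm,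
    Complex.normSq_apply]
  simp only [Complex.add_re, Complex.add_im, Complex.mul_re, Complex.mul_im, Complex.ofReal_re,
    Complex.ofReal_im, Complex.I_re, Complex.I_im]
  have h1 := Real.cosh_sq u
  have h2 := Real.sin_sq_add_cos_sq δ
  linear_combination Real.cos δ ^ 2 * h1 + Real.sinh u ^ 2 * h2

lemma exists_laplaceOnLine_bound {A B : ℝ} (hA : 0 < A) (hB : 0 < B) :
    ∃ C, ∀ δ s : ℝ, 0 ≤ Real.cos δ → ‖laplaceOnLine A B δ s‖ ≤ C * (Real.cosh s)⁻¹ := by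
  obtain ⟨C, hC⟩ := exists_macdonaldLaplace_bound hA hB
  have hC0 : 0 ≤ C := by simpa using (norm_nonneg _).trans (hC 0 le_rfl)
  refine ⟨C, fun δ s hδ => ?_⟩
  have hs := Real.cosh_pos s
  have h1 := hC (Complex.cosh (s + δ * Complex.I)) (by rw [re_cosh_add_mul_I]; positivity)
  rw [laplaceOnLine, norm_mul]
  calc _ ≤ Real.cosh s * (C / (1 + ‖Complex.cosh (s + δ * Complex.I)‖ ^ 2)) := by
        gcongr
        exact norm_sinh_add_mul_I_le s δ
    _ ≤ Real.cosh s * (C / Real.cosh s ^ 2) := by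
        gcongr
        rw [norm_cosh_add_mul_I_sq, Real.cosh_sq]
        nlinarith [sq_nonneg (Real.cos δ)]
    _ = _ := by field_simp

lemma continuous_laplaceOnLine {A B δ : ℝ} (hA : 0 < A) (hB : 0 < B) (hδ : 0 ≤ Real.cos δ) :
    Continuous (laplaceOnLine A B δ) := by
  refine (by fun_prop : Continuous fun s : ℝ => Complex.sinh (s + δ * Complex.I)).mul
    ((continuousOn_macdonaldLaplace hA hB).comp_continuous (by fun_prop) fun s => ?_)
  simp only [mem_ofPred_eq, re_cosh_add_mul_I]
  have := Real.cosh_pos s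
  positivity

lemma measurable_Kib : Measurable (fun q : ℝ × ℝ => Kib q.1 q.2) := by
  have h : StronglyMeasurable (Function.uncurry fun (q : ℝ × ℝ) (u : ℝ) =>
      Real.exp (-q.2 * Real.cosh u) * Real.cos (q.1 * u)) := by
    refine Continuous.stronglyMeasurable ?_
    simp only [Function.uncurry_def]
    fun_prop
  exact (h.integral_prod_right (ν := volume.restrict (Ioi 0))).measurable

lemma integrable_abs_mul_exp_neg {b : ℝ} (hb : 0 < b) :
    Integrable (fun τ : ℝ => |τ| * Real.exp (-(b * |τ|))) := by
  refine (integrable_inv_one_add_sq.const_mul (1 / b + 6 / b ^ 3)).mono' (by fun_prop)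
    (.of_forall fun τ => ?_)
  have hy : 0 ≤ b * |τ| := by positivity
  have h1 := Real.pow_div_factorial_le_exp _ hy 1
  have h3 := Real.pow_div_factorial_le_exp _ hy 3
  simp only [Nat.factorial] at h1 h3
  norm_num at h1 h3
  rw [Real.norm_of_nonneg (by positivity), Real.exp_neg, ← div_eq_mul_inv, ← div_eq_mul_inv,
    div_le_div_iff₀ (Real.exp_pos _) (by positivity)]
  calc |τ| * (1 + τ ^ 2) = 1 / b * (b * |τ|) + 6 / b ^ 3 * ((b * |τ|) ^ 3 / 6) := by
        rw [← sq_abs τ]; field_simp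
    _ ≤ 1 / b * Real.exp (b * |τ|) + 6 / b ^ 3 * Real.exp (b * |τ|) := by gcongr
    _ = _ := by ring

lemma exists_Kib_bound {x : ℝ} (hx : 0 < x) :
    ∃ C, 0 ≤ C ∧ ∀ τ, |Kib τ x| ≤ C * Real.exp (-(5 * π / 12 * |τ|)) :=
  ⟨_, K0_nonneg _, fun τ => (abs_Kib_le hx (by positivity) (by linarith [Real.pi_pos]) τ).trans_eq
    (mul_comm _ _)⟩

lemma integrable_mul_exp_mul_Kib_mul_Kib {x y δ : ℝ} (hx : 0 < x) (hy : 0 < y) (hδ : |δ| < π / 2) :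
    Integrable (fun τ : ℝ => (τ * Real.exp (δ * τ) : ℂ) * (Kib τ x * Kib τ y)) := by
  obtain ⟨C₁, hC₁, h₁⟩ := exists_Kib_bound hx
  obtain ⟨C₂, hC₂, h₂⟩ := exists_Kib_bound hy
  have hmeas (x : ℝ) : Measurable fun τ => Kib τ x :=
    measurable_Kib.comp (measurable_id.prodMk measurable_const)
  have hm₁ := hmeas x
  have hm₂ := hmeas y
  refine ((integrable_abs_mul_exp_neg (b := π / 3) (by positivity)).const_mul (C₁ * C₂)).mono'
    (by fun_prop) (.of_forall fun τ => ?_)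
  simp only [norm_mul, Complex.norm_real, Real.norm_eq_abs, Real.abs_exp]
  have hδτ : δ * τ ≤ π / 2 * |τ| := by
    refine (le_abs_self _).trans ?_
    rw [abs_mul]
    gcongr
  calc _ ≤ |τ| * Real.exp (π / 2 * |τ|) * ((C₁ * Real.exp (-(5 * π / 12 * |τ|))) *
        (C₂ * Real.exp (-(5 * π / 12 * |τ|)))) := by
        gcongr
        exacts [h₁ τ, h₂ τ]
    _ = C₁ * C₂ * (|τ| * (Real.exp (π / 2 * |τ|) * Real.exp (-(5 * π / 12 * |τ|)) *
        Real.exp (-(5 * π / 12 * |τ|)))) := by ring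
    _ = _ := by
        rw [← Real.exp_add, ← Real.exp_add]
        ring_nf

lemma integrable_abs_mul_exp_mul_Kib {x y t : ℝ} (hx : 0 < x) (hy : 0 < y) (ht : 0 < t) :
    Integrable (fun τ : ℝ => |τ| * Real.exp (π * |τ|) * |Kib τ x * Kib τ y * Kib τ t|) := by
  obtain ⟨C₁, hC₁, h₁⟩ := exists_Kib_bound hx
  obtain ⟨C₂, hC₂, h₂⟩ := exists_Kib_bound hy
  obtain ⟨C₃, hC₃, h₃⟩ := exists_Kib_bound ht
  have hmeas (x : ℝ) : Measurable fun τ => Kib τ x :=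
    measurable_Kib.comp (measurable_id.prodMk measurable_const)
  have hm₁ := hmeas x
  have hm₂ := hmeas y
  have hm₃ := hmeas t
  refine ((integrable_abs_mul_exp_neg (b := π / 4) (by positivity)).const_mul (C₁ * C₂ * C₃)).mono'
    (by fun_prop) (.of_forall fun τ => ?_)
  simp only [norm_mul, Real.norm_eq_abs, Real.abs_exp, abs_mul, abs_abs]
  calc _ ≤ |τ| * Real.exp (π * |τ|) * ((C₁ * Real.exp (-(5 * π / 12 * |τ|))) *
        (C₂ * Real.exp (-(5 * π / 12 * |τ|))) * (C₃ * Real.exp (-(5 * π / 12 * |τ|)))) := by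
        gcongr
        exacts [h₁ τ, h₂ τ, h₃ τ]
    _ = C₁ * C₂ * C₃ * (|τ| * (Real.exp (π * |τ|) * Real.exp (-(5 * π / 12 * |τ|)) *
        Real.exp (-(5 * π / 12 * |τ|)) * Real.exp (-(5 * π / 12 * |τ|)))) := by ring
    _ = _ := by
        rw [← Real.exp_add, ← Real.exp_add, ← Real.exp_add]
        ring_nf

lemma norm_exp_neg_mul_cosh_le_one {t δ : ℝ} (ht : 0 < t) (hδ : 0 ≤ Real.cos δ) (u : ℝ) :
    ‖Complex.exp (-t * Complex.cosh (u + δ * Complex.I))‖ ≤ 1 := by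
  rw [neg_mul]
  refine norm_exp_neg_mul_le_one ht ?_
  rw [re_cosh_add_mul_I]
  have := Real.cosh_pos u
  positivity

lemma integral_mul_exp_mul_Kib {x y t δ : ℝ} (hx : 0 < x) (hy : 0 < y) (ht : 0 < t)
    (hδ : |δ| < π / 2) :
    ∫ τ : ℝ, (τ * Real.exp (2 * δ * τ) : ℂ) * (Kib τ x * Kib τ y * Kib τ t) =
      -(Complex.I * π / 4) * ∫ u : ℝ, Complex.exp (-t * Complex.cosh (u + δ * Complex.I)) *
        laplaceOnLine (x * y / 2) ((x / y + y / x) / 2) δ (-u) := by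
  have hcos := cos_pos_of_abs_lt hδ
  set L := laplaceOnLine (x * y / 2) ((x / y + y / x) / 2) δ with hL
  set P : ℝ → ℂ := fun τ => (τ * Real.exp (δ * τ) : ℂ) * (Kib τ x * Kib τ y) with hP
  have hPint : Integrable P := integrable_mul_exp_mul_Kib_mul_Kib hx hy hδ
  have hPL (τ : ℝ) : P τ = -(Complex.I / 4) * ∫ s : ℝ, Complex.exp (τ * s * Complex.I) * L s :=
    mul_exp_mul_Kib_mul_Kib hx hy hδ τ
  have hLcont : Continuous L := continuous_laplaceOnLine (by positivity) (by positivity) hcos.le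
  have hLint : Integrable L := by
    obtain ⟨C, hC⟩ := exists_laplaceOnLine_bound (A := x * y / 2) (B := (x / y + y / x) / 2)
      (by positivity) (by positivity)
    exact (integrable_inv_cosh.const_mul C).mono' hLcont.aestronglyMeasurable
      (.of_forall fun s => hC δ s hcos.le)
  have hLhat : Integrable fun τ : ℝ => ∫ s : ℝ, Complex.exp (τ * s * Complex.I) * L s := by
    refine (hPint.const_mul (4 * Complex.I)).congr (.of_forall fun τ => ?_)
    simp only [hPL]
    linear_combination (-∫ s : ℝ, Complex.exp (τ * s * Complex.I) * L s) * Complex.I_sq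
  have hinner (u : ℝ) : ∫ τ : ℝ, P τ * shiftedKernel t δ τ u = -(Complex.I * π / 2) *
      (Complex.exp (-t * Complex.cosh (u + δ * Complex.I)) * L (-u)) := by
    have h := integral_fourier_inversion hLint hLhat (u := -u) hLcont.continuousAt
    have h2 : ∫ τ : ℝ, P τ * shiftedKernel t δ τ u =
        -(Complex.I / 4) * Complex.exp (-t * Complex.cosh (u + δ * Complex.I)) *
        ∫ τ : ℝ, Complex.exp (-(τ * (-u : ℝ) * Complex.I)) *
          ∫ s : ℝ, Complex.exp (τ * s * Complex.I) * L s := by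
      rw [← integral_const_mul]
      congr 1
      ext τ
      have h3 : -((τ : ℂ) * (-u : ℝ) * Complex.I) = τ * u * Complex.I := by push_cast; ring
      rw [hPL, shiftedKernel, h3]
      ring
    rw [h2, h]
    ring
  have hswap : ∫ τ : ℝ, ∫ u : ℝ, P τ * shiftedKernel t δ τ u =
      ∫ u : ℝ, ∫ τ : ℝ, P τ * shiftedKernel t δ τ u := by
    refine integral_integral_swap ?_
    refine (hPint.norm.mul_prod (integrable_exp_neg_mul_cosh (mul_pos ht hcos))).mono' ?_
      (.of_forall fun q => ?_)
    · refine hPint.aestronglyMeasurable.comp_fst.mul (Continuous.aestronglyMeasurable ?_)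
      unfold shiftedKernel
      fun_prop
    · rw [Function.uncurry_def, norm_mul, norm_shiftedKernel]
  simp_rw [hinner, integral_const_mul] at hswap
  have hlhs (τ : ℝ) : (τ * Real.exp (2 * δ * τ) : ℂ) * (Kib τ x * Kib τ y * Kib τ t) =
      1 / 2 * (P τ * ∫ u, shiftedKernel t δ τ u) := by
    have h := exp_mul_Kib ht hδ τ
    have h2 : (Real.exp (2 * δ * τ) : ℂ) = Real.exp (δ * τ) * Real.exp (δ * τ) := by
      rw [← Complex.ofReal_mul, ← Real.exp_add]; ring_nf
    rw [hP, h2]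
    linear_combination (τ * Real.exp (δ * τ) * (Kib τ x * Kib τ y) : ℂ) * h
  simp_rw [hlhs]
  rw [integral_const_mul, hswap]
  ring

lemma tendsto_laplaceOnLine {A B : ℝ} (hA : 0 < A) (hB : 0 < B) (s : ℝ) :
    Tendsto (fun δ : ℝ => laplaceOnLine A B δ s) (𝓝[<] (π / 2))
      (𝓝 (laplaceOnLine A B (π / 2) s)) := by
  have hcosh : Continuous fun δ : ℝ => Complex.cosh (s + δ * Complex.I) := by fun_prop
  have hsinh : Continuous fun δ : ℝ => Complex.sinh (s + δ * Complex.I) := by fun_prop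
  refine ((hsinh.tendsto _).mono_left nhdsWithin_le_nhds).mul ?_
  refine (continuousOn_macdonaldLaplace hA hB _ ?_).tendsto.comp
    (tendsto_nhdsWithin_iff.2 ⟨(hcosh.tendsto _).mono_left nhdsWithin_le_nhds, ?_⟩)
  · simp only [mem_ofPred_eq, re_cosh_add_mul_I]
    simp
  · filter_upwards [Ioo_mem_nhdsLT (show (0 : ℝ) < π / 2 by positivity)] with δ hδ
    simp only [re_cosh_add_mul_I]
    have := Real.cosh_pos s
    have := cos_pos_of_abs_lt (δ := δ) (by rw [abs_of_pos hδ.1]; exact hδ.2)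
    positivity

lemma integral_exp_mul_laplaceOnLine_pi_div_two {A B t : ℝ} (hA : 0 < A) (hB : 0 < B)
    (ht : 0 < t) :
    ∫ u : ℝ, Complex.exp (-t * Complex.cosh (u + (π / 2 : ℝ) * Complex.I)) *
      laplaceOnLine A B (π / 2) (-u) = 2 * π * Complex.I * macdonaldWeight A B t := by
  set f : ℝ → ℂ := (Ioi (0 : ℝ)).indicator (fun w => (macdonaldWeight A B w : ℂ)) with hf
  have hfint : Integrable f :=
    (integrable_indicator_iff measurableSet_Ioi).2 (integrableOn_macdonaldWeight hA hB).ofReal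
  have hfhat (v : ℝ) : ∫ s : ℝ, Complex.exp (v * s * Complex.I) * f s =
      macdonaldLaplace A B (-(v * Complex.I)) := by
    rw [macdonaldLaplace, ← integral_indicator measurableSet_Ioi]
    congr 1
    ext s
    simp only [hf, indicator_apply]
    split_ifs
    · ring_nf
    · simp
  have hcont : Continuous fun v : ℝ => macdonaldLaplace A B (-(v * Complex.I)) :=
    (continuousOn_macdonaldLaplace hA hB).comp_continuous (by fun_prop) (by simp)
  have hfhatint : Integrable fun v : ℝ => ∫ s : ℝ, Complex.exp (v * s * Complex.I) * f s := by
    simp_rw [hfhat]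
    obtain ⟨C, hC⟩ := exists_macdonaldLaplace_bound hA hB
    refine (integrable_inv_one_add_sq.const_mul C).mono' hcont.aestronglyMeasurable
      (.of_forall fun v => ?_)
    simpa [div_eq_mul_inv] using hC (-(v * Complex.I)) (by simp)
  have hft : ContinuousAt f t := by
    have h1 : ContinuousAt (fun w : ℝ => (macdonaldWeight A B w : ℂ)) t :=
      (hasDerivAt_macdonaldWeight A B ht).ofReal_comp.continuousAt
    refine h1.congr ?_
    filter_upwards [Ioi_mem_nhds ht] with w hw
    simp only [hf, indicator_of_mem hw]
  have hinv := integral_fourier_inversion hfint hfhatint hft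
  rw [hf, indicator_of_mem (show t ∈ Ioi (0 : ℝ) from ht)] at hinv
  rw [mul_right_comm, ← hinv]
  have hsub := integral_image_eq_integral_abs_deriv_smul MeasurableSet.univ
    (fun u _ => (Real.hasDerivAt_sinh u).hasDerivWithinAt) Real.sinh_injective.injOn
    (fun v : ℝ => Complex.exp (-(v * t * Complex.I)) *
      macdonaldLaplace A B (-(v * Complex.I)))
  rw [image_univ, Real.sinh_surjective.range_eq, setIntegral_univ, setIntegral_univ] at hsub
  simp_rw [← hf, hfhat]
  rw [hsub, ← integral_mul_const]
  congr 1
  ext u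
  have h1 : Complex.cosh (u + (π / 2 : ℝ) * Complex.I) = Real.sinh u * Complex.I := by
    rw [Complex.cosh_add, Complex.cosh_mul_I, Complex.sinh_mul_I]
    push_cast
    simp
  have h2 : Complex.cosh ((-u : ℝ) + (π / 2 : ℝ) * Complex.I) = -(Real.sinh u * Complex.I) := by
    rw [Complex.cosh_add, Complex.cosh_mul_I, Complex.sinh_mul_I]
    push_cast
    simp
  have h3 : Complex.sinh ((-u : ℝ) + (π / 2 : ℝ) * Complex.I) = Real.cosh u * Complex.I := by
    rw [Complex.sinh_add, Complex.cosh_mul_I, Complex.sinh_mul_I]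
    push_cast
    simp
  rw [laplaceOnLine, h1, h2, h3, abs_of_pos (Real.cosh_pos u), Complex.real_smul]
  ring_nf

lemma integral_mul_exp_pi_mul_Kib {x y t : ℝ} (hx : 0 < x) (hy : 0 < y) (ht : 0 < t) :
    ∫ τ : ℝ, (τ * Real.exp (π * τ) : ℂ) * (Kib τ x * Kib τ y * Kib τ t) =
      π ^ 2 / 2 * macdonaldWeight (x * y / 2) ((x / y + y / x) / 2) t := by
  set A := x * y / 2 with hAdef
  set B := (x / y + y / x) / 2 with hBdef
  have hA : 0 < A := by positivity
  have hB : 0 < B := by positivity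
  obtain ⟨C, hC⟩ := exists_laplaceOnLine_bound hA hB
  have hIoo : Ioo 0 (π / 2) ∈ 𝓝[<] (π / 2) := Ioo_mem_nhdsLT (by positivity)
  have hcos {δ : ℝ} (hδ : δ ∈ Ioo 0 (π / 2)) : |δ| < π / 2 := by
    rw [abs_of_pos hδ.1]; exact hδ.2
  have hmeas (x : ℝ) : Measurable fun τ => Kib τ x :=
    measurable_Kib.comp (measurable_id.prodMk measurable_const)
  have hm₁ := hmeas x
  have hm₂ := hmeas y
  have hm₃ := hmeas t
  have hleft : Tendsto (fun δ : ℝ => ∫ τ : ℝ,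
      (τ * Real.exp (2 * δ * τ) : ℂ) * (Kib τ x * Kib τ y * Kib τ t)) (𝓝[<] (π / 2))
      (𝓝 (∫ τ : ℝ, (τ * Real.exp (π * τ) : ℂ) * (Kib τ x * Kib τ y * Kib τ t))) := by
    refine tendsto_integral_filter_of_dominated_convergence _
      (.of_forall fun δ => by fun_prop) ?_ (integrable_abs_mul_exp_mul_Kib hx hy ht)
      (.of_forall fun τ => ?_)
    · filter_upwards [hIoo] with δ hδ
      refine .of_forall fun τ => ?_
      simp only [norm_mul, Complex.norm_real, Real.norm_eq_abs, Real.abs_exp, abs_mul]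
      have : 2 * δ * τ ≤ π * |τ| := by
        refine (le_abs_self _).trans ?_
        rw [abs_mul, abs_of_pos (by linarith [hδ.1])]
        gcongr
        linarith [hδ.2]
      gcongr
    · have : Continuous fun δ : ℝ =>
          (τ * Real.exp (2 * δ * τ) : ℂ) * (Kib τ x * Kib τ y * Kib τ t) := by fun_prop
      refine (this.tendsto' (π / 2) _ ?_).mono_left nhdsWithin_le_nhds
      rw [mul_div_cancel₀ π two_ne_zero]
  have hright : Tendsto (fun δ : ℝ => -(Complex.I * π / 4) * ∫ u : ℝ,
      Complex.exp (-t * Complex.cosh (u + δ * Complex.I)) * laplaceOnLine A B δ (-u))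
      (𝓝[<] (π / 2)) (𝓝 (-(Complex.I * π / 4) * (2 * π * Complex.I * macdonaldWeight A B t))) := by
    rw [← integral_exp_mul_laplaceOnLine_pi_div_two hA hB ht]
    refine Tendsto.const_mul _ (tendsto_integral_filter_of_dominated_convergence
      (fun u => C * (Real.cosh u)⁻¹) ?_ ?_ (integrable_inv_cosh.const_mul C)
      (.of_forall fun u => ?_))
    · filter_upwards [hIoo] with δ hδ
      have := continuous_laplaceOnLine hA hB (cos_pos_of_abs_lt (hcos hδ)).le
      exact (by fun_prop : Continuous _).aestronglyMeasurable
    · filter_upwards [hIoo] with δ hδ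
      refine .of_forall fun u => ?_
      have hc := (cos_pos_of_abs_lt (hcos hδ)).le
      rw [norm_mul, ← Real.cosh_neg u]
      exact (mul_le_of_le_one_left (norm_nonneg _) (norm_exp_neg_mul_cosh_le_one ht hc u)).trans
        (hC δ (-u) hc)
    · refine Tendsto.mul ?_ (tendsto_laplaceOnLine hA hB (-u))
      have : Continuous fun δ : ℝ => Complex.exp (-t * Complex.cosh (u + δ * Complex.I)) := by
        fun_prop
      exact (this.tendsto _).mono_left nhdsWithin_le_nhds
  have heq : (fun δ : ℝ => ∫ τ : ℝ,
      (τ * Real.exp (2 * δ * τ) : ℂ) * (Kib τ x * Kib τ y * Kib τ t)) =ᶠ[𝓝[<] (π / 2)]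
      fun δ : ℝ => -(Complex.I * π / 4) * ∫ u : ℝ,
        Complex.exp (-t * Complex.cosh (u + δ * Complex.I)) * laplaceOnLine A B δ (-u) := by
    filter_upwards [hIoo] with δ hδ using integral_mul_exp_mul_Kib hx hy ht (hcos hδ)
  rw [tendsto_nhds_unique hleft (hright.congr' heq.symm)]
  linear_combination (-(π ^ 2 : ℂ) / 2 * macdonaldWeight A B t) * Complex.I_sq

lemma integral_mul_sinh_mul_Kib {x y t : ℝ} (hx : 0 < x) (hy : 0 < y) (ht : 0 < t) :
    ∫ τ in Ioi (0 : ℝ), ((τ * Real.sinh (π * τ) : ℝ) : ℂ) * (Kib τ x * (Kib τ y * Kib τ t)) =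
      π ^ 2 / 4 * macdonaldWeight (y * t / 2) ((y / t + t / y) / 2) x := by
  have hmeas (z : ℝ) : Measurable fun τ => Kib τ z := 
    measurable_Kib.comp (measurable_id.prodMk measurable_const)
  have hint : Integrable fun τ : ℝ =>
      (τ * Real.exp (π * τ) : ℂ) * (Kib τ y * Kib τ t * Kib τ x) := by
    refine (integrable_abs_mul_exp_mul_Kib hy ht hx).mono' ?_ (.of_forall fun τ => ?_)
    · have := hmeas x
      have := hmeas y
      have := hmeas t
      exact Measurable.aestronglyMeasurable (by fun_prop)
    · have hle : Real.exp (π * τ) ≤ Real.exp (π * |τ|) := by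
        gcongr
        exact le_abs_self τ
      simp only [norm_mul, Complex.norm_real, Real.norm_eq_abs, abs_mul, Real.abs_exp]
      gcongr
  have h := integral_mul_exp_pi_mul_Kib hy ht hx
  rw [integral_eq_integral_Ioi_add_comp_neg hint] at h
  have h2 : (2 : ℂ) * ∫ τ in Ioi (0 : ℝ),
      ((τ * Real.sinh (π * τ) : ℝ) : ℂ) * (Kib τ x * (Kib τ y * Kib τ t)) =
        π ^ 2 / 2 * macdonaldWeight (y * t / 2) ((y / t + t / y) / 2) x := by
    rw [← h, ← integral_const_mul]
    refine integral_congr_ae (.of_forall fun τ => ?_)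
    simp only [Kib_neg, Real.sinh_eq]
    push_cast
    ring_nf
  linear_combination h2 / 2

lemma integral_integral_mul_mul_swap {μ : Measure ℝ} [SFinite μ] {c : ℝ → ℂ} {a₁ a₂ a₃ : ℝ → ℝ → ℂ}
    (h : Integrable (fun q : ℝ × ℝ × ℝ × ℝ =>
      c q.1 * (a₁ q.1 q.2.1 * (a₂ q.1 q.2.2.1 * a₃ q.1 q.2.2.2))) (μ.prod (μ.prod (μ.prod μ)))) :
    ∫ x, ∫ y, ∫ t, ∫ τ, c τ * (a₁ τ x * (a₂ τ y * a₃ τ t)) ∂μ ∂μ ∂μ ∂μ =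
      ∫ τ, c τ * ((∫ x, a₁ τ x ∂μ) * ((∫ y, a₂ τ y ∂μ) * ∫ t, a₃ τ t ∂μ)) ∂μ := by
  have hH := h.integral_prod_right
  calc _ = ∫ x, ∫ z : ℝ × ℝ, ∫ τ, c τ * (a₁ τ x * (a₂ τ z.1 * a₃ τ z.2)) ∂μ ∂(μ.prod μ) ∂μ := by
        refine integral_congr_ae ?_
        filter_upwards [hH.prod_right_ae] with x hx
        exact (integral_prod _ hx).symm
    _ = ∫ z : ℝ × ℝ × ℝ, ∫ τ, c τ * (a₁ τ z.1 * (a₂ τ z.2.1 * a₃ τ z.2.2)) ∂μ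
          ∂(μ.prod (μ.prod μ)) := (integral_prod _ hH).symm
    _ = ∫ τ, ∫ z : ℝ × ℝ × ℝ, c τ * (a₁ τ z.1 * (a₂ τ z.2.1 * a₃ τ z.2.2))
          ∂(μ.prod (μ.prod μ)) ∂μ := (integral_integral_swap h).symm
    _ = _ := by
        refine integral_congr_ae (.of_forall fun τ => ?_)
        simp only [integral_const_mul]
        rw [integral_prod_mul (a₁ τ) (fun w : ℝ × ℝ => a₂ τ w.1 * a₃ τ w.2),
          integral_prod_mul (a₂ τ) (a₃ τ)]

lemma norm_Kib_le_of_lt_one {p x : ℝ} (hp0 : 0 < p) (hp1 : p < 1) (hx : 0 < x) (τ : ℝ) :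
    ‖(Kib τ x : ℂ)‖ ≤ Real.exp (-(Real.arccos p * |τ|)) * K0 (p * x) := by
  have h := abs_Kib_le hx (Real.arccos_nonneg p) (Real.arccos_lt_pi_div_two.2 hp0) τ
  rwa [Real.cos_arccos (by linarith) hp1.le, mul_comm x, ← Real.norm_eq_abs,
    ← Complex.norm_real] at h

lemma pi_lt_three_mul_arccos {p : ℝ} (hp0 : 0 < p) (hp1 : p < 1 / 2) : π < 3 * Real.arccos p := by
  have h := Real.strictAntiOn_arccos (a := p) (b := 1 / 2) ⟨by linarith, by linarith⟩
    ⟨by norm_num, by norm_num⟩ hp1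
  rw [← Real.cos_pi_div_three, Real.arccos_cos (by positivity) (by linarith [Real.pi_pos])] at h
  linarith

lemma integrable_weighted_parseval_integrand {p : ℝ} (hp0 : 0 < p) (hp1 : p < 1 / 2)
    {f g h : ℝ → ℂ} (hfm : Measurable f) (hgm : Measurable g) (hhm : Measurable h)
    (hf : IntegrableOn (fun x => K0 (p * x) * ‖f x‖) (Ioi 0))
    (hg : IntegrableOn (fun x => K0 (p * x) * ‖g x‖) (Ioi 0))
    (hh : IntegrableOn (fun x => K0 (p * x) * ‖h x‖) (Ioi 0)) :
    Integrable (fun q : ℝ × ℝ × ℝ × ℝ => ((q.1 * Real.sinh (π * q.1) : ℝ) : ℂ) *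
        ((Kib q.1 q.2.1 * h q.2.1) * ((Kib q.1 q.2.2.1 * f q.2.2.1) *
          (Kib q.1 q.2.2.2 * g q.2.2.2))))
      ((volume.restrict (Ioi 0)).prod ((volume.restrict (Ioi 0)).prod
        ((volume.restrict (Ioi 0)).prod (volume.restrict (Ioi 0))))) := by
  have hδ := pi_lt_three_mul_arccos hp0 hp1
  set δ := Real.arccos p with hδdef
  have hexp : Integrable (fun τ : ℝ => |τ| * Real.exp (-((3 * δ - π) * |τ|)))
      (volume.restrict (Ioi 0)) :=
    (integrable_abs_mul_exp_neg (by linarith)).restrict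
  refine (hexp.mul_prod (hh.integrable.mul_prod (hf.integrable.mul_prod hg.integrable))).mono' ?_ ?_
  · have hK (u : ℝ × ℝ × ℝ × ℝ → ℝ) (hu : Measurable u) :
        Measurable fun q : ℝ × ℝ × ℝ × ℝ => Kib q.1 (u q) :=
      measurable_Kib.comp (measurable_fst.prodMk hu)
    have h₁ := hK (fun q => q.2.1) (by fun_prop)
    have h₂ := hK (fun q => q.2.2.1) (by fun_prop)
    have h₃ := hK (fun q => q.2.2.2) (by fun_prop)
    have hs : Measurable fun q : ℝ × ℝ × ℝ × ℝ => q.1 * Real.sinh (π * q.1) :=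
      Continuous.measurable (by fun_prop)
    exact Measurable.aestronglyMeasurable (by fun_prop)
  · simp only [Measure.prod_restrict]
    filter_upwards [ae_restrict_mem (measurableSet_Ioi.prod (measurableSet_Ioi.prod
      (measurableSet_Ioi.prod measurableSet_Ioi)))] with ⟨τ, x, y, t⟩ ⟨hτ, hx, hy, ht⟩
    simp only [mem_Ioi] at hτ hx hy ht
    have hK {z : ℝ} (hz : 0 < z) := norm_Kib_le_of_lt_one hp0 (by linarith : p < 1) hz τ
    simp only [← hδdef] at hK
    have hsinh : ‖((τ * Real.sinh (π * τ) : ℝ) : ℂ)‖ ≤ |τ| * Real.exp (π * |τ|) := by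
      have h0 : 0 ≤ Real.sinh (π * τ) := Real.sinh_nonneg_iff.2 (by positivity)
      rw [Complex.norm_real, Real.norm_eq_abs, abs_mul, abs_of_nonneg h0, abs_of_pos hτ,
        Real.sinh_eq]
      gcongr
      linarith [Real.exp_pos (π * τ), Real.exp_pos (-(π * τ))]
    have := K0_nonneg
    calc _ = ‖((τ * Real.sinh (π * τ) : ℝ) : ℂ)‖ * ((‖(Kib τ x : ℂ)‖ * ‖h x‖) *
          ((‖(Kib τ y : ℂ)‖ * ‖f y‖) * (‖(Kib τ t : ℂ)‖ * ‖g t‖))) := by simp only [norm_mul]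
      _ ≤ (|τ| * Real.exp (π * |τ|)) * ((Real.exp (-(δ * |τ|)) * K0 (p * x) * ‖h x‖) *
          ((Real.exp (-(δ * |τ|)) * K0 (p * y) * ‖f y‖) *
            (Real.exp (-(δ * |τ|)) * K0 (p * t) * ‖g t‖))) := by
        gcongr
        · exact mul_nonneg (mul_nonneg (Real.exp_pos _).le (this _)) (norm_nonneg _)
        · exact hK hx
        · exact mul_nonneg (mul_nonneg (Real.exp_pos _).le (this _)) (norm_nonneg _)
        · exact hK hy
        · exact hK ht
      _ = _ := by
        have he : Real.exp (-((3 * δ - π) * |τ|)) = Real.exp (π * |τ|) * Real.exp (-(δ * |τ|)) *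
            Real.exp (-(δ * |τ|)) * Real.exp (-(δ * |τ|)) := by
          simp only [← Real.exp_add]
          ring_nf
        rw [he]
        ring

lemma KLconv_mul_eq {f g : ℝ → ℂ} {x : ℝ} (hx : 0 < x) (w : ℂ) :
    KLconv f g x * w = ((2 / π ^ 2 : ℝ) : ℂ) * ∫ y in Ioi (0 : ℝ), ∫ t in Ioi (0 : ℝ),
      ∫ τ in Ioi (0 : ℝ), ((τ * Real.sinh (π * τ) : ℝ) : ℂ) *
        ((Kib τ x * (w / x)) * ((Kib τ y * f y) * (Kib τ t * g t))) := by
  rw [KLconv, mul_right_comm, ← integral_const_mul, ← integral_const_mul]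
  refine setIntegral_congr_fun measurableSet_Ioi fun y hy => ?_
  rw [← integral_const_mul, ← integral_const_mul]
  refine setIntegral_congr_fun measurableSet_Ioi fun t ht => ?_
  have hy' : 0 < y := hy
  have ht' : 0 < t := ht
  have hweight : macdonaldWeight (y * t / 2) ((y / t + t / y) / 2) x =
      Real.exp (-((y ^ 2 + t ^ 2) / (2 * y * t)) * x - y * t / (2 * x)) := by
    rw [macdonaldWeight]
    congr 1
    field_simp
    ring
  have hindex : ∫ τ in Ioi (0 : ℝ), ((τ * Real.sinh (π * τ) : ℝ) : ℂ) *
        ((Kib τ x * (w / x)) * ((Kib τ y * f y) * (Kib τ t * g t))) =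
      (π ^ 2 / 4 * macdonaldWeight (y * t / 2) ((y / t + t / y) / 2) x) *
        (w / x * f y * g t) := by
    rw [← integral_mul_sinh_mul_Kib hx hy' ht', ← integral_mul_const]
    refine integral_congr_ae (.of_forall fun τ => ?_)
    simp only
    ring
  have hpi : (π : ℂ) ≠ 0 := by exact_mod_cast Real.pi_ne_zero
  have hxc : (x : ℂ) ≠ 0 := by exact_mod_cast hx.ne'
  simp only [hindex, hweight]
  push_cast
  field_simp
  ring

theorem KL_conv_weighted_parseval (p : ℝ) (hp0 : 0 < p) (hp1 : p < 1/2) (f g ω : ℝ → ℂ)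
    (hfm : Measurable f) (hgm : Measurable g) (hωm : Measurable ω)
    (hf : IntegrableOn (fun x => K0 (p*x) * ‖f x‖) (Ioi 0))
    (hg : IntegrableOn (fun x => K0 (p*x) * ‖g x‖) (Ioi 0))
    (hω : IntegrableOn (fun x => K0 (p*x) * ‖ω x‖ / x) (Ioi 0)) :
    ∫ x in Ioi (0:ℝ), KLconv f g x * ω x =
      ((2/π^2 : ℝ) : ℂ) * ∫ τ in Ioi (0:ℝ), ((τ * Real.sinh (π*τ) : ℝ) : ℂ) *
        KL f τ * KL g τ * ∫ x in Ioi (0:ℝ), (Kib τ x : ℂ) * ω x / x := by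
  have hω' : IntegrableOn (fun x : ℝ => K0 (p * x) * ‖ω x / x‖) (Ioi 0) := by
    refine hω.congr_fun (fun x hx => ?_) measurableSet_Ioi
    simp only [norm_div, Complex.norm_real, Real.norm_eq_abs, abs_of_pos (mem_Ioi.1 hx)]
    ring
  have hωm' : Measurable fun x : ℝ => ω x / x := by fun_prop
  have hint := integrable_weighted_parseval_integrand hp0 hp1 hfm hgm hωm' hf hg hω'
  rw [setIntegral_congr_fun measurableSet_Ioi fun x hx => KLconv_mul_eq hx (ω x),
    integral_const_mul, integral_integral_mul_mul_swap
      (c := fun τ => ((τ * Real.sinh (π * τ) : ℝ) : ℂ)) (a₁ := fun τ x => Kib τ x * (ω x / x))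
      (a₂ := fun τ y => Kib τ y * f y) (a₃ := fun τ t => Kib τ t * g t) hint]
  congr 1
  refine integral_congr_ae (.of_forall fun τ => ?_)
  simp only [KL, mul_div_assoc]
  ring
end

section
/- Let 0 < c < 1/2 and d > 0. Then the Kontorovich–Lebedev convolution of u(t) = t^{c−1}·e^t and v(t) = t^{d−1}·e^{−t} admits the representation (u∗v)(x) = x^{d−1} ∫₀^∞ [K_d(x+y)/(x+y)^d]·e^y·y^{c+d−1} dy for every x > 0. -/
open MeasureTheory Real Set

/-- The modified Bessel function of the second kind `K_ν(z) = ∫₀^∞ exp(−z cosh u) cosh(νu) du`. -/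
noncomputable def Knu (ν z : ℝ) : ℝ := ∫ u in Ioi (0:ℝ), Real.exp (-z * Real.cosh u) * Real.cosh (ν*u)

/-- The Kontorovich–Lebedev convolution (real-valued version). -/
noncomputable def KLconvR (f g : ℝ → ℝ) (x : ℝ) : ℝ :=
  (1/(2*x)) * ∫ y in Ioi (0:ℝ), ∫ t in Ioi (0:ℝ),
    Real.exp (-((y^2+t^2)/(2*y*t))*x - y*t/(2*x)) * f y * g t

theorem integrableOn_rpow_mul_exp_neg_add_inv {d z : ℝ} (hd : 0 < d) (hz : 0 < z) :
    IntegrableOn (fun s : ℝ => s ^ (d - 1) * Real.exp (-(z * (s + s⁻¹) / 2))) (Ioi 0) := by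
  have h := integrableOn_rpow_mul_exp_neg_mul_rpow (p := 1) (s := d - 1) (b := z / 2)
    (by linarith) one_pos (by positivity)
  refine Integrable.mono' h ?_ ?_
  · exact Measurable.aestronglyMeasurable (by fun_prop)
  · filter_upwards [ae_restrict_mem measurableSet_Ioi] with s hs
    have hs' : 0 < s := hs
    rw [Real.norm_of_nonneg (by positivity), Real.rpow_one]
    gcongr
    have : 0 < z * s⁻¹ := by positivity
    linarith

/-- The substitution `s = exp u` in the kernel of the modified Bessel function. -/
theorem exp_smul_rpow_mul_exp_neg_add_inv (d z u : ℝ) :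
    |Real.exp u| • (Real.exp u ^ (d - 1) *
      Real.exp (-(z * (Real.exp u + (Real.exp u)⁻¹) / 2))) =
      Real.exp (-z * Real.cosh u) * Real.exp (d * u) := by
  rw [abs_of_pos (Real.exp_pos u), smul_eq_mul, ← Real.exp_mul, ← Real.exp_neg, Real.cosh_eq,
    ← Real.exp_add, ← Real.exp_add, ← Real.exp_add]
  congr 1
  ring

theorem integrable_exp_neg_mul_cosh_mul_exp {d z : ℝ} (hd : 0 < d) (hz : 0 < z) :
    Integrable (fun u : ℝ => Real.exp (-z * Real.cosh u) * Real.exp (d * u)) := by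
  have h := integrableOn_rpow_mul_exp_neg_add_inv hd hz
  rw [← Real.range_exp, ← image_univ, integrableOn_image_iff_integrableOn_abs_deriv_smul
    MeasurableSet.univ (fun u _ => (Real.hasDerivAt_exp u).hasDerivWithinAt)
    Real.exp_injective.injOn, integrableOn_univ] at h
  simpa only [exp_smul_rpow_mul_exp_neg_add_inv] using h

theorem integral_rpow_mul_exp_neg_add_inv {d z : ℝ} (hd : 0 < d) (hz : 0 < z) :
    ∫ s in Ioi (0:ℝ), s ^ (d - 1) * Real.exp (-(z * (s + s⁻¹) / 2)) = 2 * Knu d z := by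
  have hint := integrable_exp_neg_mul_cosh_mul_exp hd hz
  rw [← Real.range_exp, ← image_univ, integral_image_eq_integral_abs_deriv_smul
    MeasurableSet.univ (fun u _ => (Real.hasDerivAt_exp u).hasDerivWithinAt)
    Real.exp_injective.injOn, setIntegral_univ]
  simp only [exp_smul_rpow_mul_exp_neg_add_inv]
  have hneg := integral_comp_neg_Ioi 0
    (fun u : ℝ => Real.exp (-z * Real.cosh u) * Real.exp (d * u))
  rw [neg_zero] at hneg
  rw [← intervalIntegral.integral_Iic_add_Ioi hint.integrableOn hint.integrableOn, ← hneg,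
    ← integral_add hint.comp_neg.integrableOn hint.integrableOn, Knu, ← integral_const_mul]
  refine integral_congr_ae (.of_forall fun u => ?_)
  simp only [Real.cosh_neg, Real.cosh_eq (d * u), mul_neg]
  ring

/-- The inner integral of the convolution is evaluated by `t = (x y / (x + y)) s`. -/
theorem integral_KLkernel_mul_rpow_mul_exp_neg {d x y : ℝ} (hd : 0 < d) (hx : 0 < x)
    (hy : 0 < y) (a : ℝ) :
    ∫ t in Ioi (0:ℝ), Real.exp (-((y^2+t^2)/(2*y*t))*x - y*t/(2*x)) * (a * Real.exp y) *
      (t ^ (d-1) * Real.exp (-t)) =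
      2 * a * (x * y / (x + y)) ^ d * Real.exp y * Knu d (x + y) := by
  have hb : 0 < x * y / (x + y) := by positivity
  have hscale := integral_comp_mul_left_Ioi'
    (fun t => Real.exp (-((y^2+t^2)/(2*y*t))*x - y*t/(2*x)) * (a * Real.exp y) *
      (t ^ (d-1) * Real.exp (-t))) 0 hb
  rw [mul_zero] at hscale
  rw [← hscale, smul_eq_mul, ← integral_const_mul]
  have hcongr : ∀ s ∈ Ioi (0:ℝ),
      x * y / (x + y) * (Real.exp (-((y^2+(x * y / (x + y) * s)^2)/
        (2*y*(x * y / (x + y) * s)))*x - y*(x * y / (x + y) * s)/(2*x)) * (a * Real.exp y) *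
        ((x * y / (x + y) * s) ^ (d-1) * Real.exp (-(x * y / (x + y) * s)))) =
      a * (x * y / (x + y)) ^ d * Real.exp y *
        (s ^ (d - 1) * Real.exp (-((x + y) * (s + s⁻¹) / 2))) := by
    intro s hs
    have hs' : 0 < s := hs
    have hexp : Real.exp (-((y^2+(x * y / (x + y) * s)^2)/
        (2*y*(x * y / (x + y) * s)))*x - y*(x * y / (x + y) * s)/(2*x)) *
        Real.exp (-(x * y / (x + y) * s)) = Real.exp (-((x + y) * (s + s⁻¹) / 2)) := by
      rw [← Real.exp_add]
      congr 1
      field_simp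
      ring
    have hpow : x * y / (x + y) * (x * y / (x + y) * s) ^ (d-1) =
        (x * y / (x + y)) ^ d * s ^ (d - 1) := by
      rw [Real.mul_rpow hb.le hs'.le, Real.rpow_sub_one hb.ne']
      field_simp
    rw [← hexp]
    linear_combination (Real.exp (-((y^2+(x * y / (x + y) * s)^2)/
        (2*y*(x * y / (x + y) * s)))*x - y*(x * y / (x + y) * s)/(2*x)) *
        Real.exp (-(x * y / (x + y) * s)) * a * Real.exp y) * hpow
  rw [setIntegral_congr_fun measurableSet_Ioi hcongr, integral_const_mul,
    integral_rpow_mul_exp_neg_add_inv hd (by positivity)]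
  ring

theorem conv_power_exp_repr (c d : ℝ) (hc0 : 0 < c) (hc1 : c < 1/2) (hd : 0 < d) :
    ∀ x : ℝ, 0 < x →
      KLconvR (fun t => t ^ (c-1) * Real.exp t) (fun t => t ^ (d-1) * Real.exp (-t)) x =
        x ^ (d-1) * ∫ y in Ioi (0:ℝ),
          Knu d (x+y) / (x+y) ^ d * Real.exp y * y ^ (c+d-1) := by
  intro x hx
  rw [KLconvR, ← integral_const_mul, ← integral_const_mul]
  refine setIntegral_congr_fun measurableSet_Ioi fun y hy => ?_
  have hy' : 0 < y := hy
  have hpow : (x * y / (x + y)) ^ d = x ^ (d - 1) * x * y ^ d / (x + y) ^ d := by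
    rw [Real.div_rpow (by positivity) (by positivity), Real.mul_rpow hx.le hy'.le,
      Real.rpow_sub_one hx.ne']
    field_simp
  simp only [integral_KLkernel_mul_rpow_mul_exp_neg hd hx hy']
  rw [hpow, show c + d - 1 = c - 1 + d by ring, Real.rpow_add hy']
  field_simp
end
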